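/- For every n ≥ 10, there exists a pair of 2n-order graphs (G_n, H_n) and a graph F such that, with 𝓕 := {F}, for every number of rounds T > 0: ‖φ̄^{(T)}_{WL,𝓕}(G_n) − φ̄^{(T)}_{WL,𝓕}(H_n)‖ < ‖φ̄^{(T)}_WL(G_n) − φ̄^{(T)}_WL(H_n)‖; i.e., the more expressive 1-WL_𝓕 strictly decreases the distance between the normalized feature vectors. -/

import Mathlib

open scoped Classical

noncomputable section

/-- The type of 1-WL colors after `t` rounds, with initial colors in `A`.  A color at round
`t+1` is the pair of the color at round `t` together with the multiset of the neighbors'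
colors at round `t`; this encodes the colorings of the Weisfeiler--Leman algorithm up to the
injective renaming `RELABEL`. -/
def WLColor (A : Type) : ℕ → Type :=
  fun t => Nat.rec A (fun _ C => C × Multiset C) t

/-- The 1-WL coloring after `t` rounds of a finite graph `G` with initial labeling `lab`:
`C_0 := lab` and `C_{t+1}(v) := (C_t(v), {{C_t(u) : u ∈ N(v)}})`. -/
def wlColoring {V A : Type} [Fintype V] (G : SimpleGraph V) (lab : V → A) :
    (t : ℕ) → V → WLColor A t :=
  fun t => Nat.rec (motive := fun t => V → WLColor A t) lab
    (fun _ ih v => (ih v, ((Finset.univ.filter fun u => G.Adj v u).val.map ih))) t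

/-- The number of vertices of `G` having 1-WL color `c` at round `t`
(an entry of the WL feature vector `φ_t(G)`). -/
def wlCount {V A : Type} [Fintype V] (G : SimpleGraph V) (lab : V → A) (t : ℕ)
    (c : WLColor A t) : ℕ :=
  (Finset.univ.filter fun v => wlColoring G lab t v = c).card

/-- The set `Σ_t` of colors appearing in `G` at round `t`. -/
def wlColors {V A : Type} [Fintype V] (G : SimpleGraph V) (lab : V → A) (t : ℕ) :
    Finset (WLColor A t) :=
  Finset.univ.image (wlColoring G lab t)

/-- The constant labeling of an unlabeled graph. -/
def unlab {V : Type} : V → ℕ := fun _ => 0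

/-- A bundled finite graph. -/
structure FinGraph where
  n : ℕ
  adj : SimpleGraph (Fin n)

/-- `v` is contained in a vertex subset `X` of `G` such that the induced subgraph `G[X]`
is isomorphic to `F`. -/
def inSubCopy {V : Type} (G : SimpleGraph V) (F : FinGraph) (v : V) : Prop :=
  ∃ X : Finset V, v ∈ X ∧ Nonempty (G.induce (X : Set V) ≃g F.adj)

/-- The initial labeling `ℓ_𝓕` of the `1`-WL_𝓕 algorithm: two vertices get the same label
iff they agree, for every `F ∈ 𝓕`, on containment in a vertex subset inducing a subgraph
isomorphic to `F`. -/
def ellF {V : Type} (G : SimpleGraph V) (FF : Finset FinGraph) : V → Set FinGraph :=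
  fun v => {F | F ∈ FF ∧ inSubCopy G F v}

/-- The Euclidean norm of the WL feature vector `φ^{(T)}(G)`. -/
def wlNorm {V A : Type} [Fintype V] (G : SimpleGraph V) (lab : V → A) (T : ℕ) : ℝ :=
  Real.sqrt (∑ t ∈ Finset.range (T + 1), ∑ c ∈ wlColors G lab t,
    ((wlCount G lab t c : ℝ)) ^ 2)

/-- The Euclidean distance between the normalized WL feature vectors `φ̄^{(T)}` of two
graphs (the sum ranges over all colors occurring in either graph; all other coordinates of
the feature vectors vanish). -/
def wlDistN {V W A : Type} [Fintype V] [Fintype W] (G : SimpleGraph V) (labG : V → A)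
    (H : SimpleGraph W) (labH : W → A) (T : ℕ) : ℝ :=
  Real.sqrt (∑ t ∈ Finset.range (T + 1), ∑ c ∈ wlColors G labG t ∪ wlColors H labH t,
    ((wlCount G labG t c : ℝ) / wlNorm G labG T -
      (wlCount H labH t c : ℝ) / wlNorm H labH T) ^ 2)

/-- The number of pairs on which two colorings agree. -/
def agreeCount {V W C : Type} [Fintype V] [Fintype W] (f : V → C) (g : W → C) : ℕ :=
  (Finset.univ.filter fun p : V × W => f p.1 = g p.2).card

/-- The number of vertices of color `c`. -/
def fiberCard {V C : Type} [Fintype V] (f : V → C) (c : C) : ℕ :=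
  (Finset.univ.filter fun v => f v = c).card

lemma sum_card_fiber_mul {V W C : Type} [Fintype V] [Fintype W] (f : V → C) (g : W → C)
    (S : Finset C) (hS : ∀ v, f v ∈ S) :
    ∑ c ∈ S, fiberCard f c * fiberCard g c = agreeCount f g := by
  unfold agreeCount fiberCard
  rw [Finset.card_eq_sum_card_fiberwise (f := fun p : V × W => f p.1) (t := S)
    (fun p _ => hS p.1)]
  refine Finset.sum_congr rfl fun c _ => ?_
  rw [← Finset.card_product]
  congr 1
  ext ⟨v, w⟩
  simp only [Finset.mem_product, Finset.mem_filter, Finset.mem_univ, true_and]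
  constructor
  · rintro ⟨rfl, h⟩
    exact ⟨h.symm, rfl⟩
  · rintro ⟨h, rfl⟩
    exact ⟨rfl, h.symm⟩

lemma agreeCount_mono {V C D : Type} [Fintype V] (f : V → C) (g : V → D)
    (h : ∀ v w, f v = f w → g v = g w) : agreeCount f f ≤ agreeCount g g :=
  Finset.card_le_card fun p hp => by
    simp only [Finset.mem_filter, Finset.mem_univ, true_and] at hp ⊢
    exact h _ _ hp

lemma agreeCount_eq_mul_of_const {V W C : Type} [Fintype V] [Fintype W] (f : V → C) (g : W → C)
    (c : C) (hg : ∀ w, g w = c) :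
    agreeCount f g = fiberCard f c * Fintype.card W := by
  rw [agreeCount, fiberCard, ← Finset.card_univ, ← Finset.card_product]
  congr 1
  ext ⟨v, w⟩
  simp [hg]

lemma agreeCount_eq_zero {V W C : Type} [Fintype V] [Fintype W] (f : V → C) (g : W → C)
    (h : ∀ v w, f v ≠ g w) : agreeCount f g = 0 := by
  simp [agreeCount, h]

lemma agreeCount_pos {V C : Type} [Fintype V] [Nonempty V] (f : V → C) :
    0 < agreeCount f f := by
  obtain ⟨v⟩ := ‹Nonempty V›
  exact Finset.card_pos.2 ⟨(v, v), by simp⟩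

/-- The squared norm of the WL feature vector counts equally colored pairs. -/
lemma wlNorm_eq {V A : Type} [Fintype V] (G : SimpleGraph V) (lab : V → A) (T : ℕ) :
    wlNorm G lab T = Real.sqrt (∑ t ∈ Finset.range (T + 1),
      agreeCount (wlColoring G lab t) (wlColoring G lab t) : ℕ) := by
  unfold wlNorm
  congr 1
  push_cast
  refine Finset.sum_congr rfl fun t _ => ?_
  rw [← sum_card_fiber_mul _ _ (wlColors G lab t) (by simp [wlColors])]
  push_cast
  exact Finset.sum_congr rfl fun c _ => by rw [sq]; rfl

lemma wlNorm_pos {V A : Type} [Fintype V] [Nonempty V] (G : SimpleGraph V) (lab : V → A) (T : ℕ) :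
    0 < wlNorm G lab T := by
  rw [wlNorm_eq, Real.sqrt_pos, Nat.cast_pos]
  exact Finset.sum_pos (fun _ _ => agreeCount_pos _) (by simp)

lemma wlNorm_sq {V A : Type} [Fintype V] (G : SimpleGraph V) (lab : V → A) (T : ℕ) :
    wlNorm G lab T ^ 2 = ∑ t ∈ Finset.range (T + 1),
      (agreeCount (wlColoring G lab t) (wlColoring G lab t) : ℝ) := by
  rw [wlNorm_eq, Real.sq_sqrt (Nat.cast_nonneg _)]
  push_cast
  rfl

/-- The squared distance of unit vectors in terms of their inner product. -/
lemma wlDistN_eq {V W A : Type} [Fintype V] [Fintype W] [Nonempty V] [Nonempty W]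
    (G : SimpleGraph V) (labG : V → A) (H : SimpleGraph W) (labH : W → A) (T : ℕ) :
    wlDistN G labG H labH T = Real.sqrt (2 - 2 * ((∑ t ∈ Finset.range (T + 1),
      (agreeCount (wlColoring G labG t) (wlColoring H labH t) : ℝ)) /
        (wlNorm G labG T * wlNorm H labH T))) := by
  have ha := (wlNorm_pos G labG T).ne'
  have hb := (wlNorm_pos H labH T).ne'
  have hA := wlNorm_sq G labG T
  have hB := wlNorm_sq H labH T
  unfold wlDistN
  congr 1
  set a := wlNorm G labG T
  set b := wlNorm H labH T
  have hround : ∀ t, ∑ c ∈ wlColors G labG t ∪ wlColors H labH t,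
      ((wlCount G labG t c : ℝ) / a - (wlCount H labH t c : ℝ) / b) ^ 2 =
      (agreeCount (wlColoring G labG t) (wlColoring G labG t) : ℝ) / a ^ 2 +
      (agreeCount (wlColoring H labH t) (wlColoring H labH t) : ℝ) / b ^ 2 -
      2 * ((agreeCount (wlColoring G labG t) (wlColoring H labH t) : ℝ) / (a * b)) := by
    intro t
    have hG : ∀ v, wlColoring G labG t v ∈ wlColors G labG t ∪ wlColors H labH t :=
      fun v => Finset.mem_union_left _ (by simp [wlColors])
    have hH : ∀ v, wlColoring H labH t v ∈ wlColors G labG t ∪ wlColors H labH t :=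
      fun v => Finset.mem_union_right _ (by simp [wlColors])
    rw [← sum_card_fiber_mul _ (wlColoring G labG t) _ hG,
      ← sum_card_fiber_mul _ (wlColoring H labH t) _ hH,
      ← sum_card_fiber_mul _ (wlColoring H labH t) _ hG]
    push_cast
    rw [Finset.sum_div, Finset.sum_div, Finset.sum_div, Finset.mul_sum,
      ← Finset.sum_add_distrib, ← Finset.sum_sub_distrib]
    refine Finset.sum_congr rfl fun c _ => ?_
    unfold wlCount fiberCard
    field_simp
    ring
  rw [Finset.sum_congr rfl fun t _ => hround t, Finset.sum_sub_distrib, Finset.sum_add_distrib,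
    ← Finset.sum_div, ← Finset.sum_div, ← Finset.mul_sum, ← Finset.sum_div, ← hA, ← hB,
    div_self (pow_ne_zero 2 ha), div_self (pow_ne_zero 2 hb)]
  ring

/-- The number of neighbors of a vertex. -/
def nbrCount {V : Type} [Fintype V] (G : SimpleGraph V) (v : V) : ℕ :=
  (Finset.univ.filter fun u => G.Adj v u).card

lemma wlColoring_succ {V A : Type} [Fintype V] (G : SimpleGraph V) (lab : V → A) (t : ℕ) (v : V) :
    wlColoring G lab (t + 1) v = (wlColoring G lab t v,
      (Finset.univ.filter fun u => G.Adj v u).val.map (wlColoring G lab t)) := rfl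

/-- WL colors refine the initial labels. -/
lemma lab_eq_of_wlColoring_eq {V A : Type} [Fintype V] (G : SimpleGraph V) (lab : V → A) (t : ℕ) :
    ∀ v w, wlColoring G lab t v = wlColoring G lab t w → lab v = lab w := by
  induction t with
  | zero => exact fun v w h => h
  | succ t ih =>
    intro v w h
    rw [wlColoring_succ, wlColoring_succ] at h
    exact ih v w (congrArg Prod.fst h)

/-- Vertices with the same WL color see the same labels on their neighbors. -/
lemma exists_adj_lab_eq {V A : Type} [Fintype V] (G : SimpleGraph V) (lab : V → A) (t : ℕ)
    {v w u : V} (h : wlColoring G lab (t + 1) v = wlColoring G lab (t + 1) w) (hu : G.Adj v u) :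
    ∃ x, G.Adj w x ∧ lab x = lab u := by
  rw [wlColoring_succ, wlColoring_succ] at h
  have h2 := congrArg Prod.snd h
  have hmem : wlColoring G lab t u ∈
      (Finset.univ.filter fun u => G.Adj v u).val.map (wlColoring G lab t) :=
    Multiset.mem_map_of_mem _ (by simpa using hu)
  simp only at h2
  rw [h2, Multiset.mem_map] at hmem
  obtain ⟨x, hx, hxu⟩ := hmem
  exact ⟨x, by simpa using hx, lab_eq_of_wlColoring_eq G lab t _ _ hxu⟩

/-- On a regular graph with constant labels, all WL colors agree. -/
lemma wlColoring_const {V A : Type} [Fintype V] (G : SimpleGraph V) (lab : V → A) (a : A)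
    (hlab : ∀ v, lab v = a) (d : ℕ) (hd : ∀ v, nbrCount G v = d)
    (t : ℕ) : ∃ c, ∀ v, wlColoring G lab t v = c := by
  induction t with
  | zero => exact ⟨a, hlab⟩
  | succ t ih =>
    obtain ⟨c, hc⟩ := ih
    refine ⟨(c, Multiset.replicate d c), fun v => ?_⟩
    rw [wlColoring_succ, Multiset.map_congr rfl fun x _ => hc x, Multiset.map_const', hc v]
    congr 2
    exact hd v

lemma agreeCount_of_regular {V A : Type} [Fintype V] (G : SimpleGraph V) (lab : V → A) (a : A)
    (hlab : ∀ v, lab v = a) (d : ℕ) (hd : ∀ v, nbrCount G v = d)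
    (t : ℕ) : agreeCount (wlColoring G lab t) (wlColoring G lab t) = Fintype.card V ^ 2 := by
  obtain ⟨c, hc⟩ := wlColoring_const G lab a hlab d hd t
  simp [agreeCount_eq_mul_of_const _ _ c hc, fiberCard, hc, sq]

lemma wlColoring_succ_ne {V W A : Type} [Fintype V] [Fintype W] (G : SimpleGraph V) (labG : V → A)
    (H : SimpleGraph W) (labH : W → A) (t : ℕ) (v : V) (w : W)
    (h : nbrCount G v ≠ nbrCount H w) :
    wlColoring G labG (t + 1) v ≠ wlColoring H labH (t + 1) w := by
  intro he
  rw [wlColoring_succ, wlColoring_succ] at he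
  have := congrArg Multiset.card (congrArg Prod.snd he)
  simp only [Multiset.card_map] at this
  exact h this

/-- Between regular graphs of different degrees only the initial round contributes to the inner
product of the feature vectors. -/
lemma sum_agreeCount_of_degree_ne {V W A : Type} [Fintype V] [Fintype W] (G : SimpleGraph V)
    (labG : V → A) (H : SimpleGraph W) (labH : W → A) (T : ℕ)
    (h : ∀ v w, nbrCount G v ≠ nbrCount H w) :
    ∑ t ∈ Finset.range (T + 1),
      (agreeCount (wlColoring G labG t) (wlColoring H labH t) : ℝ) = agreeCount labG labH := by
  rw [Finset.sum_range_succ', Finset.sum_eq_zero, zero_add]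
  · rfl
  · intro t _
    rw [agreeCount_eq_zero _ _ fun v w => wlColoring_succ_ne G labG H labH t v w (h v w)]
    simp

/-- The complete graph on three vertices. -/
def triangle : FinGraph := ⟨3, ⊤⟩

lemma inSubCopy_triangle_iff {V : Type} (G : SimpleGraph V) (v : V) :
    inSubCopy G triangle v ↔ ∃ a b, G.Adj v a ∧ G.Adj v b ∧ G.Adj a b := by
  constructor
  · rintro ⟨X, hv, ⟨e⟩⟩
    have key : ∀ i j : Fin 3, i ≠ j → G.Adj (e.symm i).1 (e.symm j).1 := fun i j hij =>
      e.symm.map_adj_iff.2 (show (⊤ : SimpleGraph (Fin 3)).Adj i j from hij)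
    obtain ⟨i, hi⟩ : ∃ i : Fin 3, (e.symm i).1 = v := ⟨e ⟨v, hv⟩, by simp⟩
    refine ⟨(e.symm (i + 1 : Fin 3)).1, (e.symm (i + 2 : Fin 3)).1, ?_, ?_, ?_⟩
    · rw [← hi]; exact key _ _ (by fin_cases i <;> decide)
    · rw [← hi]; exact key _ _ (by fin_cases i <;> decide)
    · exact key _ _ (by fin_cases i <;> decide)
  · rintro ⟨a, b, ha, hb, hab⟩
    have h3 : G.IsNClique 3 {v, a, b} := SimpleGraph.is3Clique_triple_iff.2 ⟨ha, hb, hab⟩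
    refine ⟨{v, a, b}, by simp, ⟨?_⟩⟩
    rw [SimpleGraph.induce_eq_top.2 h3.isClique]
    exact SimpleGraph.Iso.completeGraph (Fintype.equivFinOfCardEq (by simpa [triangle] using h3.card_eq))

/-- The cycle `0, 1, …, 2n - 1` with the chords `{i, -i}` and `{0, n}`. -/
def cappedLadder (n : ℕ) : SimpleGraph (Fin (2 * n)) :=
  SimpleGraph.fromRel fun i j =>
    i.1 + 1 = j.1 ∨ (i.1 = 0 ∧ j.1 + 1 = 2 * n) ∨ i.1 + j.1 = 2 * n ∨ (i.1 = 0 ∧ j.1 = n)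

lemma cappedLadder_adj {n : ℕ} (i j : Fin (2 * n)) : (cappedLadder n).Adj i j ↔ i.1 ≠ j.1 ∧
    (i.1 + 1 = j.1 ∨ j.1 + 1 = i.1 ∨ (i.1 = 0 ∧ j.1 + 1 = 2 * n) ∨ (j.1 = 0 ∧ i.1 + 1 = 2 * n) ∨
      i.1 + j.1 = 2 * n ∨ (i.1 = 0 ∧ j.1 = n) ∨ (j.1 = 0 ∧ i.1 = n)) := by
  rw [cappedLadder, SimpleGraph.fromRel_adj, ne_eq, Fin.ext_iff]
  omega

lemma card_cappedLadder_adj {n : ℕ} (hn : 10 ≤ n) (i : Fin (2 * n)) :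
    nbrCount (cappedLadder n) i = 3 := by
  have hi := i.2
  obtain ⟨a, b, c, ha, hb, hc, hab, hac, hbc, h⟩ : ∃ a b c : ℕ, a < 2 * n ∧ b < 2 * n ∧ c < 2 * n ∧
      a ≠ b ∧ a ≠ c ∧ b ≠ c ∧
      ∀ j : Fin (2 * n), (cappedLadder n).Adj i j ↔ j.1 = a ∨ j.1 = b ∨ j.1 = c := by
    simp only [cappedLadder_adj]
    rcases Nat.eq_zero_or_pos i.1 with h0 | h0
    · exact ⟨1, 2 * n - 1, n, by omega, by omega, by omega, by omega, by omega, by omega,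
        fun j => by have := j.2; omega⟩
    rcases eq_or_ne i.1 n with h1 | h1
    · exact ⟨n - 1, n + 1, 0, by omega, by omega, by omega, by omega, by omega, by omega,
        fun j => by have := j.2; omega⟩
    rcases eq_or_ne (i.1 + 1) (2 * n) with h2 | h2
    · exact ⟨2 * n - 2, 0, 1, by omega, by omega, by omega, by omega, by omega, by omega,
        fun j => by have := j.2; omega⟩
    · exact ⟨i.1 - 1, i.1 + 1, 2 * n - i.1, by omega, by omega, by omega, by omega, by omega,
        by omega, fun j => by have := j.2; omega⟩
  rw [nbrCount, Finset.card_eq_three]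
  refine ⟨⟨a, ha⟩, ⟨b, hb⟩, ⟨c, hc⟩, by simpa, by simpa, by simpa, ?_⟩
  ext j
  simp [h, Fin.ext_iff]

/-- The vertices at distance at most one from `0` or `n` on the cycle. -/
def capVertices (n : ℕ) : Finset ℕ := {0, 1, 2 * n - 1, n - 1, n, n + 1}

/-- The vertices at distance two from `0` or `n` on the cycle. -/
def capNeighbors (n : ℕ) : Finset ℕ := {2, 2 * n - 2, n - 2, n + 2}

lemma inSubCopy_cappedLadder_iff {n : ℕ} (hn : 10 ≤ n) (i : Fin (2 * n)) :
    inSubCopy (cappedLadder n) triangle i ↔ i.1 ∈ capVertices n := by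
  have hi := i.2
  rw [inSubCopy_triangle_iff]
  simp only [cappedLadder_adj, capVertices, Finset.mem_insert, Finset.mem_singleton]
  constructor
  · rintro ⟨a, b, ⟨h1, h1'⟩, ⟨h2, h2'⟩, h3, h3'⟩
    have := a.2
    have := b.2
    rcases h1' with h | h | h | h | h | h | h <;>
    rcases h2' with h' | h' | h' | h' | h' | h' | h' <;> omega
  · have mk : ∀ a b : ℕ, a < 2 * n → b < 2 * n → ∃ x y : Fin (2 * n), x.1 = a ∧ y.1 = b :=
      fun a b ha hb => ⟨⟨a, ha⟩, ⟨b, hb⟩, rfl, rfl⟩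
    rintro (h | h | h | h | h | h)
    · obtain ⟨a, b, ha, hb⟩ := mk 1 (2 * n - 1) (by omega) (by omega)
      exact ⟨a, b, by omega, by omega, by omega⟩
    · obtain ⟨a, b, ha, hb⟩ := mk 0 (2 * n - 1) (by omega) (by omega)
      exact ⟨a, b, by omega, by omega, by omega⟩
    · obtain ⟨a, b, ha, hb⟩ := mk 0 1 (by omega) (by omega)
      exact ⟨a, b, by omega, by omega, by omega⟩
    · obtain ⟨a, b, ha, hb⟩ := mk n (n + 1) (by omega) (by omega)
      exact ⟨a, b, by omega, by omega, by omega⟩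
    · obtain ⟨a, b, ha, hb⟩ := mk (n - 1) (n + 1) (by omega) (by omega)
      exact ⟨a, b, by omega, by omega, by omega⟩
    · obtain ⟨a, b, ha, hb⟩ := mk n (n - 1) (by omega) (by omega)
      exact ⟨a, b, by omega, by omega, by omega⟩

lemma exists_adj_capVertices_iff {n : ℕ} (hn : 10 ≤ n) (i : Fin (2 * n))
    (hi : i.1 ∉ capVertices n) :
    (∃ j, (cappedLadder n).Adj i j ∧ j.1 ∈ capVertices n) ↔ i.1 ∈ capNeighbors n := by
  have hi2 := i.2
  simp only [cappedLadder_adj, capVertices, capNeighbors, Finset.mem_insert,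
    Finset.mem_singleton] at hi ⊢
  constructor
  · rintro ⟨j, ⟨h1, h1'⟩, h2⟩
    have := j.2
    rcases h1' with h | h | h | h | h | h | h <;> omega
  · rintro (h | h | h | h)
    · exact ⟨⟨1, by omega⟩, by dsimp only; omega, by dsimp only; omega⟩
    · exact ⟨⟨2 * n - 1, by omega⟩, by dsimp only; omega, by dsimp only; omega⟩
    · exact ⟨⟨n - 1, by omega⟩, by dsimp only; omega, by dsimp only; omega⟩
    · exact ⟨⟨n + 1, by omega⟩, by dsimp only; omega, by dsimp only; omega⟩

lemma ellF_eq_iff {V W : Type} (G : SimpleGraph V) (H : SimpleGraph W) (F : FinGraph) (v : V)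
    (w : W) : ellF G {F} v = ellF H {F} w ↔ (inSubCopy G F v ↔ inSubCopy H F w) := by
  simp only [ellF, Finset.mem_singleton, Set.ext_iff, Set.mem_ofPred_eq]
  constructor
  · intro h
    simpa using h F
  · rintro h K
    constructor
    · rintro ⟨rfl, hK⟩
      exact ⟨rfl, h.1 hK⟩
    · rintro ⟨rfl, hK⟩
      exact ⟨rfl, h.2 hK⟩

lemma not_inSubCopy_triangle_bot {V : Type} (v : V) :
    ¬ inSubCopy (⊥ : SimpleGraph V) triangle v := by
  simp [inSubCopy_triangle_iff]

lemma card_filter_fin_mem {N : ℕ} (S : Finset ℕ) (hS : ∀ x ∈ S, x < N) :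
    (Finset.univ.filter fun i : Fin N => i.1 ∈ S).card = S.card :=
  Finset.card_bij (fun i _ => i.1) (by simp) (fun a _ b _ h => Fin.ext h)
    (fun x hx => ⟨⟨x, hS x hx⟩, by simpa using hx, rfl⟩)

lemma card_capVertices {n : ℕ} (hn : 10 ≤ n) :
    (Finset.univ.filter fun i : Fin (2 * n) => i.1 ∈ capVertices n).card = 6 := by
  rw [card_filter_fin_mem]
  · unfold capVertices
    repeat rw [Finset.card_insert_of_notMem
      (by simp only [Finset.mem_insert, Finset.mem_singleton]; omega)]
    simp
  · simp only [capVertices, Finset.mem_insert, Finset.mem_singleton]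
    omega

lemma card_capNeighbors {n : ℕ} (hn : 10 ≤ n) :
    (Finset.univ.filter fun i : Fin (2 * n) => i.1 ∈ capNeighbors n).card = 4 := by
  rw [card_filter_fin_mem]
  · unfold capNeighbors
    repeat rw [Finset.card_insert_of_notMem
      (by simp only [Finset.mem_insert, Finset.mem_singleton]; omega)]
    simp
  · simp only [capNeighbors, Finset.mem_insert, Finset.mem_singleton]
    omega

lemma card_not_capVertices {n : ℕ} (hn : 10 ≤ n) :
    (Finset.univ.filter fun i : Fin (2 * n) => i.1 ∉ capVertices n).card = 2 * n - 6 := by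
  have h := Finset.card_filter_add_card_filter_not (s := (Finset.univ : Finset (Fin (2 * n))))
    (fun i => i.1 ∈ capVertices n)
  rw [card_capVertices hn, Finset.card_univ, Fintype.card_fin] at h
  omega

lemma disjoint_capVertices_capNeighbors {n : ℕ} (hn : 10 ≤ n) :
    Disjoint (capVertices n) (capNeighbors n) := by
  rw [Finset.disjoint_left]
  simp only [capVertices, capNeighbors, Finset.mem_insert, Finset.mem_singleton]
  omega

lemma card_not_cap {n : ℕ} (hn : 10 ≤ n) :
    (Finset.univ.filter fun i : Fin (2 * n) =>
      i.1 ∉ capVertices n ∧ i.1 ∉ capNeighbors n).card = 2 * n - 10 := by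
  have h := Finset.card_filter_add_card_filter_not (s := (Finset.univ : Finset (Fin (2 * n))))
    (fun i => i.1 ∈ capVertices n ∨ i.1 ∈ capNeighbors n)
  rw [Finset.filter_or, Finset.card_union_of_disjoint, card_capVertices hn, card_capNeighbors hn,
    Finset.card_univ, Fintype.card_fin] at h
  · simp only [not_or] at h
    omega
  · exact Finset.disjoint_filter.2 fun i _ h1 h2 =>
      Finset.disjoint_left.1 (disjoint_capVertices_capNeighbors hn) h1 h2

lemma agreeCount_cappedLadder_zero {n : ℕ} (hn : 10 ≤ n) :
    agreeCount (wlColoring (cappedLadder n) (ellF (cappedLadder n) {triangle}) 0)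
      (wlColoring (cappedLadder n) (ellF (cappedLadder n) {triangle}) 0) ≤
      36 + (2 * n - 6) ^ 2 := by
  refine (agreeCount_mono _ (fun i : Fin (2 * n) => i.1 ∈ capVertices n) ?_).trans ?_
  · intro v w h
    have h' := (ellF_eq_iff _ _ _ _ _).1 (lab_eq_of_wlColoring_eq _ _ 0 v w h)
    rw [inSubCopy_cappedLadder_iff hn, inSubCopy_cappedLadder_iff hn] at h'
    exact propext h'
  · rw [← sum_card_fiber_mul _ _ {True, False} (by simp [em])]
    rw [Finset.sum_pair (by simp)]
    simp only [fiberCard, eq_iff_iff, iff_true, iff_false]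
    rw [card_capVertices hn, card_not_capVertices hn, sq]

lemma agreeCount_cappedLadder_succ {n : ℕ} (hn : 10 ≤ n) (t : ℕ) :
    agreeCount (wlColoring (cappedLadder n) (ellF (cappedLadder n) {triangle}) (t + 1))
      (wlColoring (cappedLadder n) (ellF (cappedLadder n) {triangle}) (t + 1)) ≤
      52 + (2 * n - 10) ^ 2 := by
  let cls : Fin (2 * n) → Fin 3 := fun i =>
    if i.1 ∈ capVertices n then 0 else if i.1 ∈ capNeighbors n then 1 else 2
  refine (agreeCount_mono _ cls ?_).trans ?_
  · intro v w h
    have hL : ∀ x y : Fin (2 * n), ellF (cappedLadder n) {triangle} x =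
        ellF (cappedLadder n) {triangle} y → (x.1 ∈ capVertices n ↔ y.1 ∈ capVertices n) := by
      intro x y hxy
      rw [← inSubCopy_cappedLadder_iff hn, ← inSubCopy_cappedLadder_iff hn]
      exact (ellF_eq_iff _ _ _ _ _).1 hxy
    have h1 := hL v w (lab_eq_of_wlColoring_eq _ _ _ v w h)
    have transfer : ∀ x y : Fin (2 * n),
        wlColoring (cappedLadder n) (ellF (cappedLadder n) {triangle}) (t + 1) x =
          wlColoring (cappedLadder n) (ellF (cappedLadder n) {triangle}) (t + 1) y →
        x.1 ∉ capVertices n → y.1 ∉ capVertices n →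
        x.1 ∈ capNeighbors n → y.1 ∈ capNeighbors n := by
      intro x y hxy hx hy hx'
      obtain ⟨j, hj, hjc⟩ := (exists_adj_capVertices_iff hn x hx).2 hx'
      obtain ⟨k, hk, hkj⟩ := exists_adj_lab_eq _ _ t hxy hj
      exact (exists_adj_capVertices_iff hn y hy).1 ⟨k, hk, (hL k j hkj).2 hjc⟩
    by_cases hv : v.1 ∈ capVertices n
    · simp [cls, hv, h1.1 hv]
    · have hw : w.1 ∉ capVertices n := fun hw => hv (h1.2 hw)
      have h2 : v.1 ∈ capNeighbors n ↔ w.1 ∈ capNeighbors n :=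
        ⟨transfer v w h hv hw, transfer w v h.symm hw hv⟩
      simp [cls, hv, hw, h2]
  · rw [← sum_card_fiber_mul cls cls Finset.univ (by simp), Fin.sum_univ_three]
    have h0 : fiberCard cls 0 = 6 := by
      rw [← card_capVertices hn]
      unfold fiberCard
      congr 1
      ext i
      by_cases h1 : i.1 ∈ capVertices n <;> by_cases h2 : i.1 ∈ capNeighbors n <;>
        simp [cls, h1, h2]
    have h1 : fiberCard cls 1 = 4 := by
      rw [← card_capNeighbors hn]
      unfold fiberCard
      congr 1
      ext i
      have hdisj : i.1 ∈ capVertices n → i.1 ∉ capNeighbors n :=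
        fun h => Finset.disjoint_left.1 (disjoint_capVertices_capNeighbors hn) h
      by_cases h1 : i.1 ∈ capVertices n
      · simp [cls, h1, hdisj h1]
      · by_cases h2 : i.1 ∈ capNeighbors n <;> simp [cls, h1, h2]
    have h2 : fiberCard cls 2 = 2 * n - 10 := by
      rw [← card_not_cap hn]
      unfold fiberCard
      congr 1
      ext i
      by_cases h1 : i.1 ∈ capVertices n <;> by_cases h2 : i.1 ∈ capNeighbors n <;>
        simp [cls, h1, h2]
    rw [h0, h1, h2, sq]

lemma wlNorm_ellF_cappedLadder_lt {n : ℕ} (hn : 10 ≤ n) {T : ℕ} (hT : 0 < T) :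
    wlNorm (cappedLadder n) (ellF (cappedLadder n) {triangle}) T <
      (2 * n - 6 : ℝ) * Real.sqrt (T + 1) := by
  have hn' : (10 : ℝ) ≤ n := by exact_mod_cast hn
  have hT' : (1 : ℝ) ≤ T := by exact_mod_cast hT
  refine lt_of_pow_lt_pow_left₀ 2 (mul_nonneg (by linarith) (Real.sqrt_nonneg _)) ?_
  rw [mul_pow, Real.sq_sqrt (by positivity), wlNorm_sq, Finset.sum_range_succ']
  have h0 : (agreeCount (wlColoring (cappedLadder n) (ellF (cappedLadder n) {triangle}) 0)
      (wlColoring (cappedLadder n) (ellF (cappedLadder n) {triangle}) 0) : ℝ) ≤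
      36 + (2 * n - 6) ^ 2 := by
    have h : ((2 * n - 6 : ℕ) : ℝ) = 2 * n - 6 := by
      rw [Nat.cast_sub (by omega)]; push_cast; ring
    rw [← h]
    exact_mod_cast agreeCount_cappedLadder_zero hn
  have h1 : ∑ t ∈ Finset.range T,
      (agreeCount (wlColoring (cappedLadder n) (ellF (cappedLadder n) {triangle}) (t + 1))
      (wlColoring (cappedLadder n) (ellF (cappedLadder n) {triangle}) (t + 1)) : ℝ) ≤
      T * (52 + (2 * n - 10) ^ 2) := by
    have h : ((2 * n - 10 : ℕ) : ℝ) = 2 * n - 10 := by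
      rw [Nat.cast_sub (by omega)]; push_cast; ring
    rw [← h, ← nsmul_eq_mul]
    conv_rhs => rw [← Finset.card_range T]
    exact Finset.sum_le_card_nsmul _ _ _ fun t _ => by
      exact_mod_cast agreeCount_cappedLadder_succ hn t
  nlinarith

/-- For every `n ≥ 10` there exist a pair of `2n`-order graphs `(G, H)` and
a graph `F` such that, with `𝓕 := {F}`, for every number of rounds `T > 0` the distance of
the normalized `1`-WL_𝓕 feature vectors is strictly smaller than the distance of the
normalized `1`-WL feature vectors. -/
theorem more_power_can_shrink_margin (n : ℕ) (hn : 10 ≤ n) :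
    ∃ (G H : SimpleGraph (Fin (2 * n))) (F : FinGraph),
      ∀ T : ℕ, 0 < T →
        wlDistN G (ellF G {F}) H (ellF H {F}) T < wlDistN G unlab H unlab T := by
  refine ⟨cappedLadder n, ⊥, triangle, fun T hT => ?_⟩
  have : Nonempty (Fin (2 * n)) := ⟨⟨0, by omega⟩⟩
  have hn' : (10 : ℝ) ≤ n := by exact_mod_cast hn
  have hbot : ∀ v : Fin (2 * n),
      nbrCount (⊥ : SimpleGraph (Fin (2 * n))) v = 0 := by simp [nbrCount]
  have hne : ∀ v w : Fin (2 * n), nbrCount (cappedLadder n) v ≠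
      nbrCount (⊥ : SimpleGraph (Fin (2 * n))) w := by
    intro v w
    rw [card_cappedLadder_adj hn, hbot]
    norm_num
  have hnorm : ∀ {A : Type} (G : SimpleGraph (Fin (2 * n))) (lab : Fin (2 * n) → A) (a : A) (d : ℕ),
      (∀ v, lab v = a) → (∀ v, nbrCount G v = d) →
      wlNorm G lab T = 2 * n * Real.sqrt (T + 1) := by
    intro A G lab a d hlab hd
    rw [wlNorm_eq, Finset.sum_congr rfl fun t _ => agreeCount_of_regular G lab a hlab d hd t]
    rw [Finset.sum_const, Finset.card_range, Fintype.card_fin, smul_eq_mul]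
    push_cast
    rw [mul_comm, Real.sqrt_mul (by positivity), Real.sqrt_sq (by positivity)]
  have hellbot : ∀ v : Fin (2 * n), ellF (⊥ : SimpleGraph (Fin (2 * n))) {triangle} v = ∅ := by
    intro v
    simp only [ellF, Finset.mem_singleton]
    rw [Set.eq_empty_iff_forall_notMem]
    rintro K ⟨rfl, hK⟩
    exact not_inSubCopy_triangle_bot v hK
  have hI : (agreeCount (ellF (cappedLadder n) {triangle})
      (ellF (⊥ : SimpleGraph (Fin (2 * n))) {triangle}) : ℝ) = (2 * n - 6) * (2 * n) := by
    rw [agreeCount_eq_mul_of_const _ _ ∅ hellbot]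
    have : fiberCard (ellF (cappedLadder n) {triangle}) ∅ = 2 * n - 6 := by
      rw [← card_not_capVertices hn]
      unfold fiberCard
      congr 1
      ext v
      simp only [Finset.mem_filter, Finset.mem_univ, true_and]
      rw [← hellbot v, ellF_eq_iff, inSubCopy_cappedLadder_iff hn]
      simp [not_inSubCopy_triangle_bot]
    rw [this, Fintype.card_fin, Nat.cast_mul, Nat.cast_sub (by omega)]
    push_cast
    ring
  have hJ : (agreeCount (unlab : Fin (2 * n) → ℕ) (unlab : Fin (2 * n) → ℕ) : ℝ) =
      (2 * n) * (2 * n) := by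
    rw [agreeCount_eq_mul_of_const unlab unlab 0 (fun _ => rfl)]
    simp [fiberCard, unlab]
  have hpos := wlNorm_pos (cappedLadder n) (ellF (cappedLadder n) {triangle}) T
  have hlt := wlNorm_ellF_cappedLadder_lt hn hT
  have hs : 0 < Real.sqrt ((T : ℝ) + 1) := Real.sqrt_pos.2 (by positivity)
  have hs2 : Real.sqrt ((T : ℝ) + 1) * Real.sqrt ((T : ℝ) + 1) = T + 1 :=
    Real.mul_self_sqrt (by positivity)
  rw [wlDistN_eq, wlDistN_eq, sum_agreeCount_of_degree_ne _ _ _ _ _ hne,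
    sum_agreeCount_of_degree_ne _ _ _ _ _ hne, hI, hJ, hnorm ⊥ _ ∅ 0 hellbot hbot,
    hnorm (cappedLadder n) unlab 0 3 (fun _ => rfl) (card_cappedLadder_adj hn),
    hnorm ⊥ unlab 0 0 (fun _ => rfl) hbot]
  set a := wlNorm (cappedLadder n) (ellF (cappedLadder n) {triangle}) T
  set s := Real.sqrt ((T : ℝ) + 1)
  have hT' : (1 : ℝ) ≤ T := by exact_mod_cast hT
  have hunlab : (2 * n * (2 * n) : ℝ) / (2 * n * s * (2 * n * s)) = 1 / (s * s) := by
    field_simp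
  have hell : ((2 * n - 6) * (2 * n) : ℝ) / (a * (2 * n * s)) = (2 * n - 6) / (a * s) := by
    field_simp
  rw [hunlab, hell]
  have hcos : 1 / (s * s) < (2 * n - 6 : ℝ) / (a * s) := by
    rw [div_lt_div_iff₀ (by positivity) (by positivity)]
    nlinarith
  have hsmall : 1 / (s * s) < 1 := by
    rw [hs2, div_lt_one (by positivity)]
    linarith
  exact (Real.sqrt_lt_sqrt_iff_of_pos (by linarith)).2 (by linarith)

end
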